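/- Let 𝕂 be ℝ or ℂ, let Ω ⊂ 𝕂^d be a bounded convex domain, and fix k ∈ {1,…,d}. Then d_Ω^{(k)} is a metric on Ω generating the standard topology, and the metric space (Ω, d_Ω^{(k)}) is proper (closed bounded sets are compact) and geodesic (any two points are joined by a geodesic, i.e. an isometric embedding of a compact real interval). -/

import Mathlib

open Set Metric MeasureTheory
open scoped ENNReal

noncomputable section

/-- `σ` is absolutely continuous on `[a,b]`: it is the integral of an integrable density. -/
def ACOn {E : Type*} [NormedAddCommGroup E] [NormedSpace ℝ E] (σ : ℝ → E) (a b : ℝ) : Prop :=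
  ∃ g : ℝ → E, IntervalIntegrable g volume a b ∧
    ∀ t ∈ Set.Icc a b, σ t = σ a + ∫ s in a..t, g s

variable (𝕜 : Type*) [RCLike 𝕜] {d : ℕ}

/-- The distance `δ_Ω^{(k)}(p; v)` from `p` to the boundary of `Ω`, measured as the supremum over
all `k`-dimensional `𝕜`-linear subspaces `V` containing `v` of the distance from `p` to
`(p + V) ∩ ∂Ω` (with value `∞` when some such affine plane misses the boundary). -/
noncomputable def qhDelta (Ω : Set (EuclideanSpace 𝕜 (Fin d))) (k : ℕ)
    (p v : EuclideanSpace 𝕜 (Fin d)) : ℝ≥0∞ :=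
  ⨆ (V : Submodule 𝕜 (EuclideanSpace 𝕜 (Fin d))) (_ : v ∈ V) (_ : Module.finrank 𝕜 V = k),
    EMetric.infEdist p ({q | ∃ w ∈ V, q = p + w} ∩ frontier Ω)

/-- The generalized `k`-quasi-hyperbolic metric `𝔮_Ω^{(k)}(p;v) = ‖v‖ / δ_Ω^{(k)}(p;v)`
(interpreted as `0` when `δ_Ω^{(k)}(p;v) = ∞`). -/
noncomputable def qhNorm (Ω : Set (EuclideanSpace 𝕜 (Fin d))) (k : ℕ)
    (p v : EuclideanSpace 𝕜 (Fin d)) : ℝ :=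
  ‖v‖ / (qhDelta 𝕜 Ω k p v).toReal

/-- The generalized `k`-quasi-hyperbolic distance: the infimum of `∫ 𝔮_Ω^{(k)}(σ; σ')` over
absolutely continuous curves in `Ω` joining the two points. -/
noncomputable def qhDist (Ω : Set (EuclideanSpace 𝕜 (Fin d))) (k : ℕ)
    (p q : EuclideanSpace 𝕜 (Fin d)) : ℝ :=
  sInf {L : ℝ | ∃ (a b : ℝ) (σ : ℝ → EuclideanSpace 𝕜 (Fin d)), a ≤ b ∧ ACOn σ a b ∧
    (∀ t ∈ Set.Icc a b, σ t ∈ Ω) ∧ σ a = p ∧ σ b = q ∧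
    L = ∫ t in a..b, qhNorm 𝕜 Ω k (σ t) (deriv σ t)}

/-- A (unit speed) geodesic segment for a distance function. -/
def IsGeodesicOn {X : Type*} (dist : X → X → ℝ) (γ : ℝ → X) (a b : ℝ) : Prop :=
  ∀ s ∈ Set.Icc a b, ∀ t ∈ Set.Icc a b, dist (γ s) (γ t) = |s - t|

/-- Gromov hyperbolicity of a distance function, via `δ`-slim geodesic triangles. -/
def GromovHyperbolicDist {X : Type*} (dist : X → X → ℝ) : Prop :=
  ∃ δ : ℝ, 0 ≤ δ ∧
    ∀ (γ₁ γ₂ γ₃ : ℝ → X) (a₁ b₁ a₂ b₂ a₃ b₃ : ℝ),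
      IsGeodesicOn dist γ₁ a₁ b₁ → IsGeodesicOn dist γ₂ a₂ b₂ → IsGeodesicOn dist γ₃ a₃ b₃ →
      γ₁ b₁ = γ₂ a₂ → γ₂ b₂ = γ₃ a₃ → γ₃ b₃ = γ₁ a₁ →
      ∀ s ∈ Set.Icc a₁ b₁, ∃ t, (t ∈ Set.Icc a₂ b₂ ∧ dist (γ₁ s) (γ₂ t) ≤ δ) ∨
        (t ∈ Set.Icc a₃ b₃ ∧ dist (γ₁ s) (γ₃ t) ≤ δ)

/-- `n` is an `(r,δ)`-quasi-normal vector at `x ∈ ∂Ω`: `n` is a unit vector and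
`dist(x + rn, ∂Ω) ≥ δ`. -/
def IsQuasiNormal (Ω : Set (EuclideanSpace 𝕜 (Fin d))) (r δ : ℝ)
    (x n : EuclideanSpace 𝕜 (Fin d)) : Prop :=
  ‖n‖ = 1 ∧ δ ≤ Metric.infDist (x + r • n) (frontier Ω)

/-- `δ_Ω(p;v)`: the distance from `p` to the boundary along the `𝕜`-line through `p` in
direction `v`. -/
noncomputable def lineBdryDist (Ω : Set (EuclideanSpace 𝕜 (Fin d)))
    (p v : EuclideanSpace 𝕜 (Fin d)) : ℝ :=
  Metric.infDist p ({q | ∃ c : 𝕜, q = p + c • v} ∩ frontier Ω)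

open Filter Topology

section Delta

variable {𝕜} {Ω : Set (EuclideanSpace 𝕜 (Fin d))} {k : ℕ} {p v : EuclideanSpace 𝕜 (Fin d)}

lemma exists_mem_frontier_segment {F : Type*} [NormedAddCommGroup F] [NormedSpace ℝ F]
    {Ω : Set F} (hΩ : IsOpen Ω) {x y : F} (hx : x ∈ Ω) (hy : y ∉ Ω) :
    ∃ s ∈ Set.Icc (0 : ℝ) 1, x + s • (y - x) ∈ frontier Ω := by
  by_contra! h
  have hpre : IsPreconnected (segment ℝ x y) := (convex_segment x y).isPreconnected
  have hseg : ∀ z ∈ segment ℝ x y, z ∉ frontier Ω := by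
    rw [segment_eq_image']
    rintro z ⟨s, hs, rfl⟩
    exact h s hs
  have hcov : segment ℝ x y ⊆ Ω ∪ (closure Ω)ᶜ := by
    intro z hz
    by_cases hzc : z ∈ closure Ω
    · left
      have := hseg z hz
      rw [hΩ.frontier_eq] at this
      by_contra hzΩ
      exact this ⟨hzc, hzΩ⟩
    · exact Or.inr hzc
  obtain ⟨z, -, hz1, hz2⟩ := hpre Ω (closure Ω)ᶜ hΩ isClosed_closure.isOpen_compl hcov
    ⟨x, left_mem_segment ℝ x y, hx⟩
    ⟨y, right_mem_segment ℝ x y, by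
      rcases hcov (right_mem_segment ℝ x y) with h' | h'
      · exact absurd h' hy
      · exact h'⟩
  exact hz2 (subset_closure hz1)

lemma exists_submodule_finrank_eq (hk1 : 1 ≤ k) (hkd : k ≤ d) (v : EuclideanSpace 𝕜 (Fin d)) :
    ∃ V : Submodule 𝕜 (EuclideanSpace 𝕜 (Fin d)), v ∈ V ∧ Module.finrank 𝕜 V = k := by
  induction k, hk1 using Nat.le_induction with
  | base =>
    by_cases hv : v = 0
    · have : Nontrivial (EuclideanSpace 𝕜 (Fin d)) := by
        apply Module.nontrivial_of_finrank_pos (R := 𝕜)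
        rw [finrank_euclideanSpace_fin]; omega
      obtain ⟨w, hw⟩ := exists_ne (0 : EuclideanSpace 𝕜 (Fin d))
      exact ⟨𝕜 ∙ w, by simp [hv], finrank_span_singleton hw⟩
    · exact ⟨𝕜 ∙ v, Submodule.mem_span_singleton_self v, finrank_span_singleton hv⟩
  | succ n hn ih =>
    obtain ⟨V, hvV, hV⟩ := ih (by omega)
    have hne : V ≠ ⊤ := by
      rintro rfl
      rw [finrank_top, finrank_euclideanSpace_fin] at hV
      omega
    obtain ⟨x, -, hx⟩ := SetLike.exists_of_lt (lt_top_iff_ne_top.2 hne)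
    refine ⟨V ⊔ 𝕜 ∙ x, Submodule.mem_sup_left hvV, ?_⟩
    have hx0 : x ≠ 0 := fun h => hx (h ▸ V.zero_mem)
    have h1 := Submodule.finrank_sup_add_finrank_inf_eq V (𝕜 ∙ x)
    have h2 : V ⊓ 𝕜 ∙ x = ⊥ :=
      disjoint_iff.1 ((Submodule.disjoint_span_singleton' hx0).2 hx)
    rw [h2, finrank_bot, finrank_span_singleton hx0, hV] at h1
    simpa using h1

lemma qhDelta_le_of_notMem (hΩ : IsOpen Ω) (hp : p ∈ Ω) {t : ℝ} (ht : p + t • v ∉ Ω) :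
    qhDelta 𝕜 Ω k p v ≤ ENNReal.ofReal (|t| * ‖v‖) := by
  obtain ⟨s, hs, hfr⟩ := exists_mem_frontier_segment hΩ hp ht
  refine iSup_le fun V => iSup_le fun hv => iSup_le fun _ => ?_
  have hmem : p + s • (p + t • v - p) ∈ {q | ∃ w ∈ V, q = p + w} ∩ frontier Ω := by
    refine ⟨⟨s • (p + t • v - p), ?_, rfl⟩, hfr⟩
    rw [add_sub_cancel_left, RCLike.real_smul_eq_coe_smul (K := 𝕜) s,
      RCLike.real_smul_eq_coe_smul (K := 𝕜) t]
    exact V.smul_mem _ (V.smul_mem _ hv)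
  refine (Metric.infEDist_le_edist_of_mem hmem).trans ?_
  rw [edist_dist]
  apply ENNReal.ofReal_le_ofReal
  rw [dist_self_add_right, add_sub_cancel_left, norm_smul, norm_smul, Real.norm_eq_abs,
    Real.norm_eq_abs, abs_of_nonneg hs.1]
  exact mul_le_of_le_one_left (by positivity) hs.2

lemma le_qhDelta (hΩ : IsOpen Ω) (hk1 : 1 ≤ k) (hkd : k ≤ d) {r : ℝ} (h : ball p r ⊆ Ω) :
    ENNReal.ofReal r ≤ qhDelta 𝕜 Ω k p v := by
  obtain ⟨V, hv, hV⟩ := exists_submodule_finrank_eq hk1 hkd v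
  refine le_trans ?_ (le_iSup_of_le V (le_iSup_of_le hv (le_iSup_of_le hV le_rfl)))
  refine Metric.le_infEDist.2 fun y hy => ?_
  rw [edist_dist]
  apply ENNReal.ofReal_le_ofReal
  by_contra! hlt
  have hyΩ : y ∈ Ω := h (by rwa [mem_ball, dist_comm])
  exact (hΩ.inter_frontier_eq ▸ ⟨hyΩ, hy.2⟩ : y ∈ (∅ : Set _))

lemma qhDelta_neg : qhDelta 𝕜 Ω k p (-v) = qhDelta 𝕜 Ω k p v := by
  simp [qhDelta]

lemma qhNorm_neg : qhNorm 𝕜 Ω k p (-v) = qhNorm 𝕜 Ω k p v := by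
  simp [qhNorm, qhDelta_neg]

lemma qhNorm_nonneg : 0 ≤ qhNorm 𝕜 Ω k p v := by
  unfold qhNorm; positivity

@[simp] lemma qhNorm_zero : qhNorm 𝕜 Ω k p 0 = 0 := by
  simp [qhNorm]

lemma norm_div_le_qhNorm (hΩ : IsOpen Ω) (hk1 : 1 ≤ k) (hkd : k ≤ d) (hp : p ∈ Ω) {t : ℝ}
    (ht : p + t • v ∉ Ω) : |t|⁻¹ ≤ qhNorm 𝕜 Ω k p v := by
  have ht0 : t ≠ 0 := by rintro rfl; simp [hp] at ht
  have hv0 : v ≠ 0 := by rintro rfl; simp [hp] at ht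
  obtain ⟨r, hr, hball⟩ := Metric.isOpen_iff.1 hΩ p hp
  have hle := qhDelta_le_of_notMem (k := k) hΩ hp ht
  have hge := le_qhDelta (𝕜 := 𝕜) (k := k) (v := v) hΩ hk1 hkd hball
  have hpos : 0 < (qhDelta 𝕜 Ω k p v).toReal :=
    ENNReal.toReal_pos (fun h => by simp [h, hr.not_ge] at hge)
      (ne_top_of_le_ne_top ENNReal.ofReal_ne_top hle)
  have hle' : (qhDelta 𝕜 Ω k p v).toReal ≤ |t| * ‖v‖ :=
    ENNReal.toReal_le_of_le_ofReal (by positivity) hle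
  unfold qhNorm
  rw [le_div_iff₀ hpos]
  have : 0 < |t| := abs_pos.2 ht0
  rw [inv_mul_le_iff₀ this]
  exact hle'

lemma qhNorm_le (hΩ : IsOpen Ω) (hΩb : Bornology.IsBounded Ω) (hk1 : 1 ≤ k) (hkd : k ≤ d)
    {r : ℝ} (hr : 0 < r) (h : ball p r ⊆ Ω) : qhNorm 𝕜 Ω k p v ≤ ‖v‖ / r := by
  by_cases hv : v = 0
  · simp [hv]
  have hp : p ∈ Ω := h (mem_ball_self hr)
  obtain ⟨D, hD⟩ := hΩb.subset_ball p
  have hD0 : 0 < D := by simpa using hD hp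
  have hv' : 0 < ‖v‖ := norm_pos_iff.2 hv
  have hnot : p + (D / ‖v‖) • v ∉ Ω := by
    intro h'
    have := hD h'
    rw [mem_ball, dist_self_add_left, norm_smul, Real.norm_eq_abs, abs_of_pos (by positivity),
      div_mul_cancel₀ _ hv'.ne'] at this
    exact lt_irrefl _ this
  have hle := qhDelta_le_of_notMem (k := k) hΩ hp hnot
  have hge := le_qhDelta (𝕜 := 𝕜) (k := k) (v := v) hΩ hk1 hkd h
  have hr' : r ≤ (qhDelta 𝕜 Ω k p v).toReal :=
    (ENNReal.ofReal_le_iff_le_toReal (ne_top_of_le_ne_top ENNReal.ofReal_ne_top hle)).1 hge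
  unfold qhNorm
  gcongr

/-- A bounded open set yields a uniform lower bound on the quasi-hyperbolic norm. -/
lemma exists_mul_norm_le_qhNorm (hΩ : IsOpen Ω) (hΩb : Bornology.IsBounded Ω) (hk1 : 1 ≤ k)
    (hkd : k ≤ d) : ∃ D : ℝ, 0 < D ∧
      ∀ p ∈ Ω, ∀ v : EuclideanSpace 𝕜 (Fin d), ‖v‖ ≤ D * qhNorm 𝕜 Ω k p v := by
  obtain ⟨R, hR, hRΩ⟩ := hΩb.subset_ball_lt 0 0
  refine ⟨2 * R, by positivity, fun p hp v => ?_⟩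
  by_cases hv : v = 0
  · simp [hv]
  have hv' : 0 < ‖v‖ := norm_pos_iff.2 hv
  have hnot : p + (2 * R / ‖v‖) • v ∉ Ω := by
    intro h'
    have h1 := hRΩ h'
    have h2 := hRΩ hp
    rw [mem_ball, dist_zero_right] at h1 h2
    have h3 : ‖(2 * R / ‖v‖) • v‖ = 2 * R := by
      rw [norm_smul, Real.norm_eq_abs, abs_of_pos (by positivity), div_mul_cancel₀ _ hv'.ne']
    have h4 := norm_sub_le (p + (2 * R / ‖v‖) • v) p
    rw [add_sub_cancel_left, h3] at h4
    linarith
  have := norm_div_le_qhNorm (k := k) hΩ hk1 hkd hp hnot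
  rw [abs_of_pos (by positivity), inv_div, div_le_iff₀ (by positivity)] at this
  linarith

lemma abs_div_le_qhNorm (hΩ : IsOpen Ω) (hk1 : 1 ≤ k) (hkd : k ≤ d)
    {l : EuclideanSpace 𝕜 (Fin d) →L[ℝ] ℝ} {c : ℝ} (hl : ∀ x ∈ Ω, l x < c) (hp : p ∈ Ω) :
    |l v| / (c - l p) ≤ qhNorm 𝕜 Ω k p v := by
  by_cases hv : l v = 0
  · simp [hv, qhNorm_nonneg]
  have hc : 0 < c - l p := sub_pos.2 (hl p hp)
  have hnot : p + ((c - l p) / l v) • v ∉ Ω := by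
    intro h'
    have := hl _ h'
    rw [map_add, map_smul, smul_eq_mul, div_mul_cancel₀ _ hv] at this
    linarith
  have := norm_div_le_qhNorm (k := k) hΩ hk1 hkd hp hnot
  rwa [abs_div, abs_of_pos hc, inv_div] at this

end Delta

section Measurability

variable {𝕜} {Ω : Set (EuclideanSpace 𝕜 (Fin d))} {k : ℕ} {p v : EuclideanSpace 𝕜 (Fin d)}
  {V : Submodule 𝕜 (EuclideanSpace 𝕜 (Fin d))}

lemma add_mem_of_norm_lt_infEDist (hΩ : IsOpen Ω) (hp : p ∈ Ω) {s : ℝ}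
    (hs : ENNReal.ofReal s < Metric.infEDist p ({q | ∃ w ∈ V, q = p + w} ∩ frontier Ω))
    {w : EuclideanSpace 𝕜 (Fin d)} (hw : w ∈ V) (hws : ‖w‖ ≤ s) : p + w ∈ Ω := by
  by_contra hnot
  obtain ⟨t, ht, hfr⟩ := exists_mem_frontier_segment hΩ hp hnot
  rw [add_sub_cancel_left] at hfr
  have hmem : p + t • w ∈ {q | ∃ w ∈ V, q = p + w} ∩ frontier Ω := by
    refine ⟨⟨t • w, ?_, rfl⟩, hfr⟩
    rw [RCLike.real_smul_eq_coe_smul (K := 𝕜) t]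
    exact V.smul_mem _ hw
  refine absurd (Metric.infEDist_le_edist_of_mem hmem) (not_le.2 (lt_of_le_of_lt ?_ hs))
  rw [edist_dist]
  apply ENNReal.ofReal_le_ofReal
  rw [dist_self_add_right, norm_smul, Real.norm_eq_abs, abs_of_nonneg ht.1]
  exact (mul_le_of_le_one_left (norm_nonneg w) ht.2).trans hws

lemma le_infEDist_of_add_mem (hΩ : IsOpen Ω) {s : ℝ}
    (h : ∀ w ∈ V, ‖w‖ ≤ s → p + w ∈ Ω) :
    ENNReal.ofReal s ≤ Metric.infEDist p ({q | ∃ w ∈ V, q = p + w} ∩ frontier Ω) := by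
  refine Metric.le_infEDist.2 ?_
  rintro _ ⟨⟨w, hw, rfl⟩, hfr⟩
  rw [edist_dist]
  apply ENNReal.ofReal_le_ofReal
  rw [dist_self_add_right]
  by_contra! hlt
  exact (hΩ.inter_frontier_eq ▸ ⟨h w hw hlt.le, hfr⟩ : p + w ∈ (∅ : Set _))

/-- The linear map `w ↦ w + (⟪v, w⟫ / ‖v‖ ^ 2) • (v' - v)`, which sends `v` to `v'`. -/
def shear (v v' : EuclideanSpace 𝕜 (Fin d)) :
    EuclideanSpace 𝕜 (Fin d) →ₗ[𝕜] EuclideanSpace 𝕜 (Fin d) :=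
  LinearMap.id +
    ((((‖v‖ : 𝕜) ^ 2)⁻¹ • (innerSL 𝕜 v).toLinearMap).smulRight (v' - v))

lemma shear_self {v' : EuclideanSpace 𝕜 (Fin d)} (hv : v ≠ 0) : shear v v' v = v' := by
  have : (‖v‖ : 𝕜) ≠ 0 := by simpa using hv
  simp [shear, inner_self_eq_norm_sq_to_K, this]

lemma norm_shear_sub_le (v' w : EuclideanSpace 𝕜 (Fin d)) :
    ‖shear v v' w - w‖ ≤ ‖v' - v‖ / ‖v‖ * ‖w‖ := by
  by_cases hv : v = 0
  · simp [shear, hv]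
  have hv' : 0 < ‖v‖ := norm_pos_iff.2 hv
  have h : shear v v' w - w = (((‖v‖ : 𝕜) ^ 2)⁻¹ * inner 𝕜 v w) • (v' - v) := by
    simp [shear]
  rw [h, norm_smul, norm_mul, norm_inv, norm_pow, RCLike.norm_ofReal, abs_norm]
  calc (‖v‖ ^ 2)⁻¹ * ‖inner 𝕜 v w‖ * ‖v' - v‖ 
      ≤ (‖v‖ ^ 2)⁻¹ * (‖v‖ * ‖w‖) * ‖v' - v‖ := by gcongr; exact norm_inner_le_norm v w
    _ = ‖v' - v‖ / ‖v‖ * ‖w‖ := by field_simp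

lemma le_qhDelta_of_shear (hΩ : IsOpen Ω) {v' p' : EuclideanSpace 𝕜 (Fin d)} (hv : v ≠ 0)
    (hvV : v ∈ V) {s₁ s₂ ε : ℝ} 
    (hε : thickening ε ((fun w => p + w) '' {w | w ∈ V ∧ ‖w‖ ≤ s₁}) ⊆ Ω)
    (h1 : ‖v' - v‖ / ‖v‖ < 1) (h2 : s₂ ≤ s₁ * (1 - ‖v' - v‖ / ‖v‖))
    (h3 : ‖p' - p‖ + ‖v' - v‖ / ‖v‖ * s₁ < ε) :
    ENNReal.ofReal s₂ ≤ qhDelta 𝕜 Ω (Module.finrank 𝕜 V) p' v' := by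
  set η := ‖v' - v‖ / ‖v‖ with hη
  have hη0 : 0 ≤ η := by positivity
  have hnorm : ∀ w, (1 - η) * ‖w‖ ≤ ‖shear v v' w‖ := by
    intro w
    have h4 := norm_shear_sub_le (v := v) v' w
    have h5 := norm_sub_norm_le w (shear v v' w)
    rw [norm_sub_rev] at h5
    linarith
  have hinj : Function.Injective (shear v v') := by
    rw [injective_iff_map_eq_zero]
    intro w hw
    have := hnorm w
    rw [hw, norm_zero] at this
    have h6 : 0 < 1 - η := by linarith
    exact norm_le_zero_iff.1 (by nlinarith [norm_nonneg w])
  have hrank : Module.finrank 𝕜 (V.map (shear v v')) = Module.finrank 𝕜 V :=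
    (LinearEquiv.finrank_eq (Submodule.equivMapOfInjective _ hinj V)).symm
  refine le_trans ?_ (le_iSup_of_le (V.map (shear v v'))
    (le_iSup_of_le ⟨v, hvV, shear_self hv⟩ (le_iSup_of_le hrank le_rfl)))
  refine le_infEDist_of_add_mem hΩ ?_
  rintro _ ⟨w, hw, rfl⟩ hws
  have hw1 : ‖w‖ ≤ s₁ := by
    have h6 : 0 < 1 - η := by linarith
    have h7 := hnorm w
    refine le_of_mul_le_mul_left ?_ h6
    linarith
  apply hε
  rw [mem_thickening_iff]
  refine ⟨p + w, ⟨w, ⟨hw, hw1⟩, rfl⟩, ?_⟩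
  rw [dist_eq_norm]
  calc ‖p' + shear v v' w - (p + w)‖ = ‖(p' - p) + (shear v v' w - w)‖ := by congr 1; abel
    _ ≤ ‖p' - p‖ + ‖shear v v' w - w‖ := norm_add_le _ _
    _ ≤ ‖p' - p‖ + η * s₁ := by
      gcongr
      exact (norm_shear_sub_le v' w).trans (by gcongr)
    _ < ε := h3

lemma isOpen_setOf_lt_qhDelta (hΩ : IsOpen Ω) (k : ℕ) (s : ℝ≥0∞) :
    IsOpen {x : EuclideanSpace 𝕜 (Fin d) × EuclideanSpace 𝕜 (Fin d) |
      x.1 ∈ Ω ∧ x.2 ≠ 0 ∧ s < qhDelta 𝕜 Ω k x.1 x.2} := by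
  rw [isOpen_iff_mem_nhds]
  rintro ⟨p, v⟩ ⟨hp, hv, hs⟩
  simp only at hp hv hs
  unfold qhDelta at hs
  simp only [lt_iSup_iff] at hs
  obtain ⟨V, hvV, rfl, hs⟩ := hs
  obtain ⟨s₁, hss₁, hs₁⟩ := ENNReal.lt_iff_exists_nnreal_btwn.1 hs
  obtain ⟨s₂, hss₂, hs₂⟩ := ENNReal.lt_iff_exists_nnreal_btwn.1 hss₁
  have hs₂₁ : (s₂ : ℝ) < s₁ := by exact_mod_cast hs₂
  rw [← ENNReal.ofReal_coe_nnreal] at hs₁ hss₂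
  set K := (fun w => p + w) '' {w | w ∈ V ∧ ‖w‖ ≤ (s₁ : ℝ)} with hK
  have hKc : IsCompact K := by
    refine IsCompact.image ?_ (by fun_prop)
    have : {w | w ∈ V ∧ ‖w‖ ≤ (s₁ : ℝ)} = (V : Set _) ∩ closedBall 0 s₁ := by
      ext; simp
    rw [this]
    exact (isCompact_closedBall _ _).inter_left V.closed_of_finiteDimensional
  have hKΩ : K ⊆ Ω := by
    rintro _ ⟨w, ⟨hw, hws⟩, rfl⟩
    exact add_mem_of_norm_lt_infEDist hΩ hp hs₁ hw hws
  obtain ⟨ε, hε, hεΩ⟩ := hKc.exists_thickening_subset_open hΩ hKΩ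
  have hη : Tendsto (fun x : EuclideanSpace 𝕜 (Fin d) × EuclideanSpace 𝕜 (Fin d) =>
      ‖x.2 - v‖ / ‖v‖) (𝓝 (p, v)) (𝓝 0) := by
    have : Continuous (fun x : EuclideanSpace 𝕜 (Fin d) × EuclideanSpace 𝕜 (Fin d) =>
      ‖x.2 - v‖ / ‖v‖) := by fun_prop
    simpa using this.tendsto (p, v)
  have hη2 : Tendsto (fun x : EuclideanSpace 𝕜 (Fin d) × EuclideanSpace 𝕜 (Fin d) =>
      (s₁ : ℝ) * (1 - ‖x.2 - v‖ / ‖v‖)) (𝓝 (p, v)) (𝓝 s₁) := by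
    simpa using (hη.const_sub 1).const_mul (s₁ : ℝ)
  have hη3 : Tendsto (fun x : EuclideanSpace 𝕜 (Fin d) × EuclideanSpace 𝕜 (Fin d) =>
      ‖x.1 - p‖ + ‖x.2 - v‖ / ‖v‖ * s₁) (𝓝 (p, v)) (𝓝 0) := by
    have : Continuous (fun x : EuclideanSpace 𝕜 (Fin d) × EuclideanSpace 𝕜 (Fin d) =>
      ‖x.1 - p‖) := by fun_prop
    simpa using (this.tendsto (p, v)).add (hη.mul_const (s₁ : ℝ))
  have hΩ1 : ∀ᶠ x : EuclideanSpace 𝕜 (Fin d) × EuclideanSpace 𝕜 (Fin d) in 𝓝 (p, v),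
      x.1 ∈ Ω := continuous_fst.continuousAt.eventually (hΩ.mem_nhds hp)
  have hv1 : ∀ᶠ x : EuclideanSpace 𝕜 (Fin d) × EuclideanSpace 𝕜 (Fin d) in 𝓝 (p, v),
      x.2 ≠ 0 := continuous_snd.continuousAt.eventually_ne hv
  filter_upwards [hΩ1, hv1, hη.eventually (gt_mem_nhds one_pos),
    hη2.eventually (lt_mem_nhds hs₂₁), hη3.eventually (gt_mem_nhds hε)] with x hx1 hx2 hx3 hx4 hx5
  exact ⟨hx1, hx2, hss₂.trans_le (le_qhDelta_of_shear hΩ hv hvV hεΩ hx3 hx4.le hx5)⟩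

/-- The quasi-hyperbolic norm, extended by zero in the base point, is Borel measurable. -/
lemma measurable_indicator_qhNorm (hΩ : IsOpen Ω) (k : ℕ) :
    Measurable (indicator {x : EuclideanSpace 𝕜 (Fin d) × EuclideanSpace 𝕜 (Fin d) | x.1 ∈ Ω}
      fun x => qhNorm 𝕜 Ω k x.1 x.2) := by
  set F : EuclideanSpace 𝕜 (Fin d) × EuclideanSpace 𝕜 (Fin d) → ℝ≥0∞ :=
    indicator {x | x.1 ∈ Ω ∧ x.2 ≠ 0} fun x => qhDelta 𝕜 Ω k x.1 x.2 with hF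
  have hFm : Measurable F := by
    refine measurable_of_Ioi fun s => ?_
    have : F ⁻¹' Ioi s = {x | x.1 ∈ Ω ∧ x.2 ≠ 0 ∧ s < qhDelta 𝕜 Ω k x.1 x.2} := by
      ext x
      simp only [hF, mem_preimage, mem_Ioi, indicator, mem_ofPred_eq]
      split_ifs with h
      · simp [h]
      · simp only [not_lt_zero, false_iff]
        exact fun h' => h ⟨h'.1, h'.2.1⟩
    rw [this]
    exact (isOpen_setOf_lt_qhDelta hΩ k s).measurableSet
  have hm : Measurable fun x : EuclideanSpace 𝕜 (Fin d) × EuclideanSpace 𝕜 (Fin d) =>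
      ‖x.2‖ / (F x).toReal := (measurable_snd.norm).div hFm.ennreal_toReal
  have hms : MeasurableSet
      {x : EuclideanSpace 𝕜 (Fin d) × EuclideanSpace 𝕜 (Fin d) | x.1 ∈ Ω} :=
    measurable_fst hΩ.measurableSet
  convert hm.indicator hms using 1
  ext x
  simp only [indicator, mem_ofPred_eq]
  split_ifs with h
  · by_cases hx : x.2 = 0
    · simp [hx]
    · simp [hF, qhNorm, h, hx]
  · rfl

end Measurability

section AbsolutelyContinuousCurves

variable {F : Type*} [NormedAddCommGroup F] [NormedSpace ℝ F] {σ τ : ℝ → F} {a b c : ℝ}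

lemma ACOn.continuousOn (h : ACOn σ a b) (hab : a ≤ b) : ContinuousOn σ (Icc a b) := by
  obtain ⟨g, hg, hσ⟩ := h
  have h1 : ContinuousOn (fun t => σ a + ∫ s in a..t, g s) (Icc a b) := by
    have := intervalIntegral.continuousOn_primitive_interval' hg left_mem_uIcc
    rw [uIcc_of_le hab] at this
    exact continuousOn_const.add this
  exact h1.congr hσ

lemma ACOn.congr (h : ACOn σ a b) (hab : a ≤ b) (he : EqOn τ σ (Icc a b)) : ACOn τ a b := by
  obtain ⟨g, hg, hσ⟩ := h
  refine ⟨g, hg, fun t ht => ?_⟩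
  rw [he ht, he (left_mem_Icc.2 hab), hσ t ht]

lemma ae_mem_Ioo_of_ae_mem_uIoc (hab : a ≤ b) {P : ℝ → Prop}
    (h : ∀ᵐ t, t ∈ Ioo a b → P t) : ∀ᵐ t, t ∈ uIoc a b → P t := by
  have hb : ∀ᵐ t : ℝ, t ≠ b := by simp [ae_iff, measure_singleton]
  filter_upwards [h, hb] with t ht htb htm
  rw [uIoc_of_le hab] at htm
  exact ht ⟨htm.1, lt_of_le_of_ne htm.2 htb⟩

lemma ACOn.comp_add_right (h : ACOn σ a b) (c : ℝ) :
    ACOn (fun t => σ (t + c)) (a - c) (b - c) := by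
  obtain ⟨g, hg, hσ⟩ := h
  refine ⟨fun t => g (t + c), hg.comp_add_right c, fun t ht => ?_⟩
  simp only [intervalIntegral.integral_comp_add_right, sub_add_cancel]
  exact hσ _ ⟨by linarith [ht.1], by linarith [ht.2]⟩

variable [CompleteSpace F]

lemma ACOn.exists_ae_hasDerivAt (h : ACOn σ a b) (hab : a ≤ b) :
    ∃ g : ℝ → F, IntervalIntegrable g volume a b ∧
      (∀ t ∈ Icc a b, σ t = σ a + ∫ s in a..t, g s) ∧
      ∀ᵐ t, t ∈ Ioo a b → HasDerivAt σ (g t) t := by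
  obtain ⟨g, hg, hσ⟩ := h
  refine ⟨g, hg, hσ, ?_⟩
  filter_upwards [hg.ae_hasDerivAt_integral] with t ht htm
  have h1 := (ht (by rw [uIcc_of_le hab]; exact Ioo_subset_Icc_self htm) a
    left_mem_uIcc).const_add (σ a)
  refine h1.congr_of_eventuallyEq ?_
  filter_upwards [isOpen_Ioo.mem_nhds htm] with s hs
  exact hσ s (Ioo_subset_Icc_self hs)

lemma ACOn.intervalIntegrable_deriv (h : ACOn σ a b) (hab : a ≤ b) :
    IntervalIntegrable (deriv σ) volume a b := by
  obtain ⟨g, hg, hσ, hd⟩ := h.exists_ae_hasDerivAt hab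
  refine hg.congr_ae ?_
  rw [Filter.EventuallyEq, ae_restrict_iff' measurableSet_uIoc]
  refine ae_mem_Ioo_of_ae_mem_uIoc hab ?_
  filter_upwards [hd] with t ht htm
  exact (ht htm).deriv.symm

lemma ACOn.ae_hasDerivAt (h : ACOn σ a b) (hab : a ≤ b) :
    ∀ᵐ t, t ∈ Ioo a b → HasDerivAt σ (deriv σ t) t := by
  obtain ⟨g, hg, hσ, hd⟩ := h.exists_ae_hasDerivAt hab
  filter_upwards [hd] with t ht htm
  exact (ht htm).differentiableAt.hasDerivAt

lemma ACOn.integral_deriv (h : ACOn σ a b) (hab : a ≤ b) {s t : ℝ} (hs : s ∈ Icc a b)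
    (ht : t ∈ Icc a b) : ∫ r in s..t, deriv σ r = σ t - σ s := by
  obtain ⟨g, hg, hσ, hd⟩ := h.exists_ae_hasDerivAt hab
  have h1 : ∀ t ∈ Icc a b, ∫ r in a..t, deriv σ r = σ t - σ a := by
    intro t ht
    rw [hσ t ht, add_sub_cancel_left]
    refine intervalIntegral.integral_congr_ae (ae_mem_Ioo_of_ae_mem_uIoc ht.1 ?_)
    filter_upwards [hd] with r hr hrm
    exact (hr ⟨hrm.1, hrm.2.trans_le ht.2⟩).deriv
  have hi := h.intervalIntegrable_deriv hab
  have hsub : ∀ t ∈ Icc a b, IntervalIntegrable (deriv σ) volume a t := fun t ht =>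
    hi.mono_set (by rw [uIcc_of_le ht.1, uIcc_of_le hab]; exact Icc_subset_Icc_right ht.2)
  rw [← intervalIntegral.integral_interval_sub_left (hsub t ht) (hsub s hs), h1 t ht, h1 s hs]
  abel

lemma ACOn.mono (h : ACOn σ a b) {s t : ℝ} (has : a ≤ s) (hst : s ≤ t) (htb : t ≤ b) :
    ACOn σ s t := by
  have hab := has.trans (hst.trans htb)
  refine ⟨deriv σ, (h.intervalIntegrable_deriv hab).mono_set ?_, fun r hr => ?_⟩
  · rw [uIcc_of_le hst, uIcc_of_le hab]
    exact Icc_subset_Icc has htb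
  · rw [h.integral_deriv hab ⟨has, hst.trans htb⟩ ⟨has.trans hr.1, hr.2.trans htb⟩]
    abel

lemma ACOn.trans (h₁ : ACOn σ a b) (h₂ : ACOn σ b c) (hab : a ≤ b) (hbc : b ≤ c) :
    ACOn σ a c := by
  have hi₁ := h₁.intervalIntegrable_deriv hab
  have hi₂ := h₂.intervalIntegrable_deriv hbc
  refine ⟨deriv σ, hi₁.trans hi₂, fun t ht => ?_⟩
  rcases le_total t b with htb | htb
  · rw [h₁.integral_deriv hab (left_mem_Icc.2 hab) ⟨ht.1, htb⟩]
    abel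
  · rw [← intervalIntegral.integral_add_adjacent_intervals hi₁ (hi₂.mono_set ?_),
      h₁.integral_deriv hab (left_mem_Icc.2 hab) (right_mem_Icc.2 hab),
      h₂.integral_deriv hbc (left_mem_Icc.2 hbc) ⟨htb, ht.2⟩]
    · abel
    · rw [uIcc_of_le htb, uIcc_of_le hbc]
      exact Icc_subset_Icc_right ht.2

lemma ACOn.comp_neg (h : ACOn σ a b) (hab : a ≤ b) : ACOn (fun t => σ (-t)) (-b) (-a) := by
  refine ⟨fun t => -deriv σ (-t), ?_, fun t ht => ?_⟩
  · have := (h.intervalIntegrable_deriv hab).comp_sub_left 0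
    simp only [zero_sub] at this
    exact this.symm.neg
  · have ht' : -t ∈ Icc a b := ⟨by linarith [ht.2], by linarith [ht.1]⟩
    simp only [intervalIntegral.integral_neg, intervalIntegral.integral_comp_neg, neg_neg]
    rw [h.integral_deriv hab ht' (right_mem_Icc.2 hab)]
    abel

end AbsolutelyContinuousCurves

section AbsolutelyContinuousFunctions

lemma AbsolutelyContinuousOnInterval.lipschitzOnWith_comp {f g : ℝ → ℝ} {a b : ℝ} {K : NNReal}
    {s : Set ℝ} (hf : AbsolutelyContinuousOnInterval f a b) (hg : LipschitzOnWith K g s)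
    (hs : MapsTo f (uIcc a b) s) : AbsolutelyContinuousOnInterval (fun t => g (f t)) a b := by
  rw [absolutelyContinuousOnInterval_iff] at hf ⊢
  intro ε hε
  obtain ⟨δ, hδ, h⟩ := hf (ε / (K + 1)) (by positivity)
  refine ⟨δ, hδ, fun E hE hEδ => ?_⟩
  calc ∑ i ∈ Finset.range E.1, dist (g (f (E.2 i).1)) (g (f (E.2 i).2))
      ≤ ∑ i ∈ Finset.range E.1, K * dist (f (E.2 i).1) (f (E.2 i).2) :=
        Finset.sum_le_sum fun i hi =>
          hg.dist_le_mul _ (hs (hE.1 i hi).1) _ (hs (hE.1 i hi).2)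
    _ = K * ∑ i ∈ Finset.range E.1, dist (f (E.2 i).1) (f (E.2 i).2) :=
        (Finset.mul_sum _ _ _).symm
    _ ≤ K * (ε / (K + 1)) := by gcongr; exact (h E hE hEδ).le
    _ < (K + 1) * (ε / (K + 1)) := by gcongr; linarith
    _ = ε := by field

lemma lipschitzOnWith_log_Ici {m : NNReal} (hm : 0 < m) :
    LipschitzOnWith m⁻¹ Real.log (Ici (m : ℝ)) := by
  have hm' : (0 : ℝ) < m := hm
  have key : ∀ x ∈ Ici (m : ℝ), ∀ y ∈ Ici (m : ℝ),
      Real.log x - Real.log y ≤ (m : ℝ)⁻¹ * |x - y| := by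
    intro x hx y hy
    have hx0 : 0 < x := hm'.trans_le hx
    have hy0 : 0 < y := hm'.trans_le hy
    rw [← Real.log_div hx0.ne' hy0.ne']
    calc Real.log (x / y) ≤ x / y - 1 := Real.log_le_sub_one_of_pos (by positivity)
      _ = y⁻¹ * (x - y) := by field_simp
      _ ≤ y⁻¹ * |x - y| := by gcongr; exact le_abs_self _
      _ ≤ (m : ℝ)⁻¹ * |x - y| := by gcongr; exact hy
  refine LipschitzOnWith.of_dist_le_mul fun x hx y hy => ?_
  rw [Real.dist_eq, Real.dist_eq, NNReal.coe_inv, abs_le]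
  have := key y hy x hx
  rw [abs_sub_comm] at this
  exact ⟨by linarith, key x hx y hy⟩

end AbsolutelyContinuousFunctions

section Curves

variable {Ω : Set (EuclideanSpace 𝕜 (Fin d))} {k : ℕ} {p q z : EuclideanSpace 𝕜 (Fin d)}
  {σ τ : ℝ → EuclideanSpace 𝕜 (Fin d)} {a b : ℝ}

/-- The quasi-hyperbolic length of `σ` over `[a, b]`. -/
def qhLength (Ω : Set (EuclideanSpace 𝕜 (Fin d))) (k : ℕ) (σ : ℝ → EuclideanSpace 𝕜 (Fin d))
    (a b : ℝ) : ℝ :=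
  ∫ t in a..b, qhNorm 𝕜 Ω k (σ t) (deriv σ t)

variable {𝕜}

/-- `σ` is an absolutely continuous curve in `Ω` over `[a, b]`. -/
structure IsACCurveIn (Ω : Set (EuclideanSpace 𝕜 (Fin d))) (σ : ℝ → EuclideanSpace 𝕜 (Fin d))
    (a b : ℝ) : Prop where
  le : a ≤ b
  ac : ACOn σ a b
  mem : ∀ t ∈ Icc a b, σ t ∈ Ω

lemma IsACCurveIn.mono (h : IsACCurveIn Ω σ a b) {s t : ℝ} (has : a ≤ s) (hst : s ≤ t)
    (htb : t ≤ b) : IsACCurveIn Ω σ s t :=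
  ⟨hst, h.ac.mono has hst htb, fun r hr => h.mem r ⟨has.trans hr.1, hr.2.trans htb⟩⟩

lemma qhLength_congr (hab : a ≤ b) (he : EqOn σ τ (Icc a b)) :
    qhLength 𝕜 Ω k σ a b = qhLength 𝕜 Ω k τ a b := by
  refine intervalIntegral.integral_congr_ae (ae_mem_Ioo_of_ae_mem_uIoc hab ?_)
  filter_upwards with t ht
  have hev : σ =ᶠ[𝓝 t] τ := by
    filter_upwards [isOpen_Ioo.mem_nhds ht] with s hs
    exact he (Ioo_subset_Icc_self hs)
  rw [hev.deriv_eq, he (Ioo_subset_Icc_self ht)]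

lemma qhLength_nonneg (hab : a ≤ b) : 0 ≤ qhLength 𝕜 Ω k σ a b :=
  intervalIntegral.integral_nonneg hab fun _ _ => qhNorm_nonneg

lemma qhLength_comp_add_right (c : ℝ) :
    qhLength 𝕜 Ω k (fun t => σ (t + c)) (a - c) (b - c) = qhLength 𝕜 Ω k σ a b := by
  unfold qhLength
  simp only [deriv_comp_add_const]
  rw [intervalIntegral.integral_comp_add_right (fun t => qhNorm 𝕜 Ω k (σ t) (deriv σ t))]
  simp

lemma qhLength_comp_neg :
    qhLength 𝕜 Ω k (fun t => σ (-t)) (-b) (-a) = qhLength 𝕜 Ω k σ a b := by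
  unfold qhLength
  simp only [deriv_comp_neg, qhNorm_neg]
  rw [intervalIntegral.integral_comp_neg (fun t => qhNorm 𝕜 Ω k (σ t) (deriv σ t))]
  simp

lemma IsACCurveIn.comp_neg (h : IsACCurveIn Ω σ a b) :
    IsACCurveIn Ω (fun t => σ (-t)) (-b) (-a) :=
  ⟨neg_le_neg h.le, h.ac.comp_neg h.le,
    fun t ht => h.mem _ ⟨by linarith [ht.2], by linarith [ht.1]⟩⟩

lemma IsACCurveIn.comp_add_right (h : IsACCurveIn Ω σ a b) (c : ℝ) :
    IsACCurveIn Ω (fun t => σ (t + c)) (a - c) (b - c) :=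
  ⟨by linarith [h.le], h.ac.comp_add_right c,
    fun t ht => h.mem _ ⟨by linarith [ht.1], by linarith [ht.2]⟩⟩

lemma IsACCurveIn.intervalIntegrable (h : IsACCurveIn Ω σ a b) (hΩ : IsOpen Ω)
    (hΩb : Bornology.IsBounded Ω) (hk1 : 1 ≤ k) (hkd : k ≤ d) :
    IntervalIntegrable (fun t => qhNorm 𝕜 Ω k (σ t) (deriv σ t)) volume a b := by
  have hcont := h.ac.continuousOn h.le
  have hK : IsCompact (σ '' Icc a b) := isCompact_Icc.image_of_continuousOn hcont
  obtain ⟨r, hr, hrΩ⟩ := hK.exists_thickening_subset_open hΩ (by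
    rintro _ ⟨t, ht, rfl⟩; exact h.mem t ht)
  have hbound : ∀ t ∈ Icc a b, qhNorm 𝕜 Ω k (σ t) (deriv σ t) ≤ r⁻¹ * ‖deriv σ t‖ := by
    intro t ht
    rw [inv_mul_eq_div]
    exact qhNorm_le hΩ hΩb hk1 hkd hr
      ((ball_subset_thickening (mem_image_of_mem σ ht) r).trans hrΩ)
  rw [intervalIntegrable_iff_integrableOn_Icc_of_le h.le]
  have hd := h.ac.intervalIntegrable_deriv h.le
  rw [intervalIntegrable_iff_integrableOn_Icc_of_le h.le] at hd
  refine Integrable.mono' (hd.norm.const_mul r⁻¹) ?_ ?_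
  · have hm : AEMeasurable (fun t => (σ t, deriv σ t)) (volume.restrict (Icc a b)) :=
      (hcont.aemeasurable measurableSet_Icc).prodMk (measurable_deriv σ).aemeasurable
    have := ((measurable_indicator_qhNorm hΩ k).comp_aemeasurable hm).aestronglyMeasurable
    refine this.congr ?_
    filter_upwards [ae_restrict_mem measurableSet_Icc] with t ht
    simp [indicator, h.mem t ht]
  · filter_upwards [ae_restrict_mem measurableSet_Icc] with t ht
    rw [Real.norm_eq_abs, abs_of_nonneg qhNorm_nonneg]
    exact hbound t ht

lemma IsACCurveIn.trans {c : ℝ} (hσ : IsACCurveIn Ω σ a b) (hτ : IsACCurveIn Ω τ b c)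
    (he : σ b = τ b) (hΩ : IsOpen Ω) (hΩb : Bornology.IsBounded Ω) (hk1 : 1 ≤ k) (hkd : k ≤ d) :
    ∃ ρ, IsACCurveIn Ω ρ a c ∧ ρ a = σ a ∧ ρ c = τ c ∧
      qhLength 𝕜 Ω k ρ a c = qhLength 𝕜 Ω k σ a b + qhLength 𝕜 Ω k τ b c := by
  set ρ : ℝ → EuclideanSpace 𝕜 (Fin d) := fun t => if t ≤ b then σ t else τ t with hρ
  have h1 : EqOn ρ σ (Icc a b) := fun t ht => if_pos ht.2
  have h2 : EqOn ρ τ (Icc b c) := by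
    intro t ht
    rcases ht.1.eq_or_lt with rfl | hlt
    · simp [hρ, he]
    · exact if_neg hlt.not_ge
  have c1 : IsACCurveIn Ω ρ a b :=
    ⟨hσ.le, hσ.ac.congr hσ.le h1, fun t ht => h1 ht ▸ hσ.mem t ht⟩
  have c2 : IsACCurveIn Ω ρ b c :=
    ⟨hτ.le, hτ.ac.congr hτ.le h2, fun t ht => h2 ht ▸ hτ.mem t ht⟩
  refine ⟨ρ, ⟨hσ.le.trans hτ.le, c1.ac.trans c2.ac hσ.le hτ.le, fun t ht => ?_⟩,
    h1 (left_mem_Icc.2 hσ.le), h2 (right_mem_Icc.2 hτ.le), ?_⟩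
  · rcases le_total t b with htb | htb
    · exact c1.mem t ⟨ht.1, htb⟩
    · exact c2.mem t ⟨htb, ht.2⟩
  · rw [← qhLength_congr hσ.le h1, ← qhLength_congr hτ.le h2]
    exact (intervalIntegral.integral_add_adjacent_intervals
      (c1.intervalIntegrable hΩ hΩb hk1 hkd) (c2.intervalIntegrable hΩ hΩb hk1 hkd)).symm

lemma norm_sub_le_mul_qhLength (hΩ : IsOpen Ω)
    (hΩb : Bornology.IsBounded Ω) (hk1 : 1 ≤ k) (hkd : k ≤ d) {D : ℝ}
    (hD : ∀ p ∈ Ω, ∀ v : EuclideanSpace 𝕜 (Fin d), ‖v‖ ≤ D * qhNorm 𝕜 Ω k p v)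
    (h : IsACCurveIn Ω σ a b) : ‖σ b - σ a‖ ≤ D * qhLength 𝕜 Ω k σ a b := by
  rw [← h.ac.integral_deriv h.le (left_mem_Icc.2 h.le) (right_mem_Icc.2 h.le), qhLength,
    ← intervalIntegral.integral_const_mul]
  refine intervalIntegral.norm_integral_le_of_norm_le h.le (ae_of_all _ fun t ht => ?_)
    ((h.intervalIntegrable hΩ hΩb hk1 hkd).const_mul D)
  exact hD _ (h.mem t (Ioc_subset_Icc_self ht)) _

lemma log_sub_log_le_qhLength (hΩ : IsOpen Ω) (hΩb : Bornology.IsBounded Ω) (hk1 : 1 ≤ k)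
    (hkd : k ≤ d) {l : EuclideanSpace 𝕜 (Fin d) →L[ℝ] ℝ} {c : ℝ} (hl : ∀ x ∈ Ω, l x < c)
    (h : IsACCurveIn Ω σ a b) :
    Real.log (c - l (σ a)) - Real.log (c - l (σ b)) ≤ qhLength 𝕜 Ω k σ a b := by
  have hab := h.le
  have hd := h.ac.intervalIntegrable_deriv hab
  set g : ℝ → ℝ := fun t => l (deriv σ t) with hg
  have hgi : IntervalIntegrable g volume a b := ⟨l.integrable_comp hd.1, l.integrable_comp hd.2⟩
  set u : ℝ → ℝ := fun t => (c - l (σ a)) - ∫ s in a..t, g s with hu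
  have hsub : ∀ t ∈ Icc a b, IntervalIntegrable (deriv σ) volume a t := fun t ht =>
    hd.mono_set (by rw [uIcc_of_le ht.1, uIcc_of_le hab]; exact Icc_subset_Icc_right ht.2)
  have hueq : ∀ t ∈ Icc a b, u t = c - l (σ t) := by
    intro t ht
    simp only [hu, hg]
    rw [l.intervalIntegral_comp_comm (hsub t ht),
      h.ac.integral_deriv hab (left_mem_Icc.2 hab) ht, map_sub]
    ring
  have hucont : ContinuousOn u (Icc a b) := by
    refine ContinuousOn.congr ?_ hueq
    exact continuousOn_const.sub (l.continuous.comp_continuousOn (h.ac.continuousOn hab))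
  have hupos : ∀ t ∈ Icc a b, 0 < u t := fun t ht => by
    rw [hueq t ht]; exact sub_pos.2 (hl _ (h.mem t ht))
  obtain ⟨t₀, ht₀, hmin⟩ := isCompact_Icc.exists_isMinOn ⟨a, left_mem_Icc.2 hab⟩ hucont
  lift u t₀ to NNReal using (hupos t₀ ht₀).le with m hm
  have hm0 : 0 < m := by
    have := hupos t₀ ht₀
    rw [← hm] at this
    exact_mod_cast this
  have huac : AbsolutelyContinuousOnInterval u a b := by
    refine AbsolutelyContinuousOnInterval.sub (f := fun _ => c - l (σ a)) ?_
      (hgi.absolutelyContinuousOnInterval_intervalIntegral left_mem_uIcc)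
    exact (LipschitzWith.const _).lipschitzOnWith.absolutelyContinuousOnInterval
  have hfac := huac.lipschitzOnWith_comp (lipschitzOnWith_log_Ici hm0) (fun t ht => by
    rw [uIcc_of_le hab] at ht
    have := hmin ht
    simpa [hm] using this)
  have hint := hfac.integral_deriv_eq_sub
  have hle : ‖∫ t in a..b, deriv (fun t => Real.log (u t)) t‖ ≤ qhLength 𝕜 Ω k σ a b := by
    refine intervalIntegral.norm_integral_le_of_norm_le hab ?_
      (h.intervalIntegrable hΩ hΩb hk1 hkd)
    have hb : ∀ᵐ t : ℝ, t ≠ b := by simp [ae_iff, measure_singleton]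
    filter_upwards [h.ac.ae_hasDerivAt hab, hb] with t ht htb htm
    have htm' : t ∈ Ioo a b := ⟨htm.1, lt_of_le_of_ne htm.2 htb⟩
    have htI := Ioo_subset_Icc_self htm'
    have hdu : HasDerivAt u (-(l (deriv σ t))) t := by
      have : HasDerivAt (fun s => c - l (σ s)) (-(l (deriv σ t))) t :=
        ((l.hasFDerivAt.comp_hasDerivAt t (ht htm')).const_sub c)
      refine this.congr_of_eventuallyEq ?_
      filter_upwards [isOpen_Ioo.mem_nhds htm'] with s hs
      exact hueq s (Ioo_subset_Icc_self hs)
    rw [(hdu.log (hupos t htI).ne').deriv, Real.norm_eq_abs, abs_div, abs_neg,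
      abs_of_pos (hupos t htI), hueq t htI]
    exact abs_div_le_qhNorm hΩ hk1 hkd hl (h.mem t htI)
  rw [hint, hueq a (left_mem_Icc.2 hab), hueq b (right_mem_Icc.2 hab), Real.norm_eq_abs] at hle
  linarith [neg_abs_le (Real.log (c - l (σ b)) - Real.log (c - l (σ a)))]

lemma isACCurveIn_segment (hΩc : Convex ℝ Ω) (hp : p ∈ Ω) (hq : q ∈ Ω) :
    IsACCurveIn Ω (fun t : ℝ => p + t • (q - p)) 0 1 := by
  refine ⟨zero_le_one, ⟨fun _ => q - p, by simp, fun t ht => by simp [smul_sub]⟩, fun t ht => ?_⟩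
  exact hΩc.add_smul_sub_mem hp hq ht

lemma qhLength_segment_le (hΩ : IsOpen Ω) (hΩb : Bornology.IsBounded Ω) (hk1 : 1 ≤ k)
    (hkd : k ≤ d) {r : ℝ} (hr : 0 < r) (h : ∀ t ∈ Icc (0 : ℝ) 1, ball (p + t • (q - p)) r ⊆ Ω) :
    qhLength 𝕜 Ω k (fun t : ℝ => p + t • (q - p)) 0 1 ≤ ‖q - p‖ / r := by
  have hderiv : ∀ t : ℝ, deriv (fun t : ℝ => p + t • (q - p)) t = q - p := by
    intro t
    have := ((hasDerivAt_id t).smul_const (q - p)).const_add p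
    simpa using this.deriv
  have h1 : ‖qhLength 𝕜 Ω k (fun t : ℝ => p + t • (q - p)) 0 1‖ ≤ ‖q - p‖ / r * |1 - 0| := by
    refine intervalIntegral.norm_integral_le_of_norm_le_const fun t ht => ?_
    rw [uIoc_of_le zero_le_one] at ht
    rw [hderiv, Real.norm_eq_abs, abs_of_nonneg qhNorm_nonneg]
    exact qhNorm_le hΩ hΩb hk1 hkd hr (h t (Ioc_subset_Icc_self ht))
  simp only [sub_zero, abs_one, mul_one] at h1
  exact (le_abs_self _).trans h1

end Curves

section Distance

variable {𝕜} {Ω : Set (EuclideanSpace 𝕜 (Fin d))} {k : ℕ} {p q z : EuclideanSpace 𝕜 (Fin d)}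
  {σ : ℝ → EuclideanSpace 𝕜 (Fin d)} {a b : ℝ}

/-- `Ω` is a bounded convex open set and `1 ≤ k ≤ d`. -/
structure IsQHDomain (Ω : Set (EuclideanSpace 𝕜 (Fin d))) (k : ℕ) : Prop where
  isOpen : IsOpen Ω
  convex : Convex ℝ Ω
  isBounded : Bornology.IsBounded Ω
  one_le : 1 ≤ k
  le_dim : k ≤ d

lemma qhDist_le_qhLength (h : IsACCurveIn Ω σ a b) :
    qhDist 𝕜 Ω k (σ a) (σ b) ≤ qhLength 𝕜 Ω k σ a b := by
  refine csInf_le ⟨0, ?_⟩ ⟨a, b, σ, h.le, h.ac, h.mem, rfl, rfl, rfl⟩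
  rintro _ ⟨a, b, σ, hab, -, -, -, -, rfl⟩
  exact qhLength_nonneg hab

namespace IsQHDomain

lemma exists_qhLength_lt (hΩ : IsQHDomain Ω k) (hp : p ∈ Ω) (hq : q ∈ Ω) {L : ℝ}
    (hL : qhDist 𝕜 Ω k p q < L) :
    ∃ σ a b, IsACCurveIn Ω σ a b ∧ σ a = p ∧ σ b = q ∧ qhLength 𝕜 Ω k σ a b < L := by
  have hs := isACCurveIn_segment hΩ.convex hp hq
  obtain ⟨_, ⟨a, b, σ, hab, hac, hm, ha, hb, rfl⟩, hlt⟩ :=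
    exists_lt_of_csInf_lt
      (by exact ⟨_, 0, 1, _, hs.le, hs.ac, hs.mem, by simp, by simp, rfl⟩) hL
  exact ⟨σ, a, b, ⟨hab, hac, hm⟩, ha, hb, hlt⟩

lemma le_qhDist (hΩ : IsQHDomain Ω k) (hp : p ∈ Ω) (hq : q ∈ Ω) {m : ℝ}
    (h : ∀ σ a b, IsACCurveIn Ω σ a b → σ a = p → σ b = q → m ≤ qhLength 𝕜 Ω k σ a b) :
    m ≤ qhDist 𝕜 Ω k p q := by
  by_contra! hlt
  obtain ⟨σ, a, b, hσ, ha, hb, hl⟩ := hΩ.exists_qhLength_lt hp hq hlt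
  exact (h σ a b hσ ha hb).not_gt hl

lemma qhDist_nonneg (hΩ : IsQHDomain Ω k) (hp : p ∈ Ω) (hq : q ∈ Ω) : 0 ≤ qhDist 𝕜 Ω k p q :=
  hΩ.le_qhDist hp hq fun _ _ _ h _ _ => qhLength_nonneg h.le

lemma qhDist_comm (hΩ : IsQHDomain Ω k) (hp : p ∈ Ω) (hq : q ∈ Ω) :
    qhDist 𝕜 Ω k p q = qhDist 𝕜 Ω k q p := by
  have key : ∀ {p q}, p ∈ Ω → q ∈ Ω → qhDist 𝕜 Ω k p q ≤ qhDist 𝕜 Ω k q p := by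
    intro p q hp hq
    refine hΩ.le_qhDist hq hp fun σ a b h ha hb => ?_
    have := qhDist_le_qhLength (k := k) h.comp_neg
    rwa [qhLength_comp_neg, neg_neg, neg_neg, ha, hb] at this
  exact (key hp hq).antisymm (key hq hp)

lemma qhDist_triangle (hΩ : IsQHDomain Ω k) (hp : p ∈ Ω) (hq : q ∈ Ω) (hz : z ∈ Ω) :
    qhDist 𝕜 Ω k p z ≤ qhDist 𝕜 Ω k p q + qhDist 𝕜 Ω k q z := by
  rw [← sub_le_iff_le_add']
  refine hΩ.le_qhDist hq hz fun τ c e hτ hc he => ?_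
  rw [sub_le_iff_le_add', ← sub_le_iff_le_add]
  refine hΩ.le_qhDist hp hq fun σ a b hσ ha hb => ?_
  have hτ' := hτ.comp_add_right (c - b)
  rw [sub_sub_cancel] at hτ'
  obtain ⟨ρ, hρ, hρa, hρc, hlen⟩ := hσ.trans (k := k) hτ' (by simp [hb, hc])
    hΩ.isOpen hΩ.isBounded hΩ.one_le hΩ.le_dim
  have hlen' := qhLength_comp_add_right (𝕜 := 𝕜) (Ω := Ω) (k := k) (σ := τ) (a := c) (b := e)
    (c - b)
  rw [sub_sub_cancel] at hlen'
  have := qhDist_le_qhLength (k := k) hρ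
  rw [hρa, hρc, hlen, hlen', sub_add_cancel, ha, he] at this
  linarith

lemma exists_norm_sub_le (hΩ : IsQHDomain Ω k) :
    ∃ D, 0 < D ∧ ∀ p ∈ Ω, ∀ q ∈ Ω, ‖q - p‖ ≤ D * qhDist 𝕜 Ω k p q := by
  obtain ⟨D, hD0, hD⟩ :=
    exists_mul_norm_le_qhNorm hΩ.isOpen hΩ.isBounded hΩ.one_le hΩ.le_dim
  refine ⟨D, hD0, fun p hp q hq => ?_⟩
  rw [← div_le_iff₀' hD0]
  refine hΩ.le_qhDist hp hq fun σ a b h ha hb => ?_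
  rw [div_le_iff₀' hD0, ← ha, ← hb]
  exact norm_sub_le_mul_qhLength hΩ.isOpen hΩ.isBounded hΩ.one_le hΩ.le_dim hD h

lemma qhDist_le_of_ball_subset (hΩ : IsQHDomain Ω k) {r : ℝ} (hr : 0 < r) (h : ball p r ⊆ Ω)
    (hq : dist p q < r / 2) : qhDist 𝕜 Ω k p q ≤ ‖q - p‖ / (r / 2) := by
  have hr2 : 0 < r / 2 := half_pos hr
  have hqp : ‖q - p‖ < r / 2 := by rwa [← dist_eq_norm, dist_comm]
  have hp : p ∈ Ω := h (mem_ball_self hr)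
  have hqΩ : q ∈ Ω := h (by rw [mem_ball, dist_comm]; linarith)
  have hs := isACCurveIn_segment hΩ.convex hp hqΩ
  have h1 := qhDist_le_qhLength (k := k) hs
  simp only [zero_smul, add_zero, one_smul, add_sub_cancel] at h1
  refine h1.trans (qhLength_segment_le hΩ.isOpen hΩ.isBounded hΩ.one_le hΩ.le_dim hr2
    fun t ht => (ball_subset_ball' ?_).trans h)
  have : ‖t • (q - p)‖ ≤ 1 * ‖q - p‖ := by
    rw [norm_smul, Real.norm_eq_abs, abs_of_nonneg ht.1]
    gcongr
    exact ht.2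
  rw [dist_eq_norm, add_sub_cancel_left]
  linarith

lemma qhDist_self (hΩ : IsQHDomain Ω k) (hp : p ∈ Ω) : qhDist 𝕜 Ω k p p = 0 := by
  obtain ⟨r, hr, h⟩ := Metric.isOpen_iff.1 hΩ.isOpen p hp
  refine le_antisymm ?_ (hΩ.qhDist_nonneg hp hp)
  simpa using hΩ.qhDist_le_of_ball_subset hr h (q := p) (by simpa using half_pos hr)

lemma qhDist_eq_zero (hΩ : IsQHDomain Ω k) (hp : p ∈ Ω) (hq : q ∈ Ω) :
    qhDist 𝕜 Ω k p q = 0 ↔ p = q := by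
  refine ⟨fun h => ?_, fun h => h ▸ hΩ.qhDist_self hp⟩
  obtain ⟨D, -, hD⟩ := hΩ.exists_norm_sub_le
  have := hD p hp q hq
  rw [h, mul_zero, norm_le_zero_iff, sub_eq_zero] at this
  exact this.symm

lemma tendsto_qhDist_zero (hΩ : IsQHDomain Ω k) (hp : p ∈ Ω) :
    Tendsto (qhDist 𝕜 Ω k p) (𝓝 p) (𝓝 0) := by
  obtain ⟨r, hr, h⟩ := Metric.isOpen_iff.1 hΩ.isOpen p hp
  have hlim : Tendsto (fun q => ‖q - p‖ / (r / 2)) (𝓝 p) (𝓝 0) := by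
    have : Continuous fun q => ‖q - p‖ / (r / 2) := by fun_prop
    simpa using this.tendsto p
  refine squeeze_zero' ?_ ?_ hlim
  · filter_upwards [hΩ.isOpen.mem_nhds hp] with q hq
    exact hΩ.qhDist_nonneg hp hq
  · filter_upwards [ball_mem_nhds p (half_pos hr)] with q hq
    exact hΩ.qhDist_le_of_ball_subset hr h (by rwa [dist_comm])

lemma qhDist_le_of_tendsto (hΩ : IsQHDomain Ω k) {ι : Type*} {f : Filter ι} [f.NeBot]
    {u v : ι → EuclideanSpace 𝕜 (Fin d)} {c : ι → ℝ} {C : ℝ} (hp : p ∈ Ω) (hq : q ∈ Ω)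
    (hu : Tendsto u f (𝓝 p)) (hv : Tendsto v f (𝓝 q)) (hc : Tendsto c f (𝓝 C))
    (h : ∀ᶠ i in f, qhDist 𝕜 Ω k (u i) (v i) ≤ c i) : qhDist 𝕜 Ω k p q ≤ C := by
  have h1 := (hΩ.tendsto_qhDist_zero hp).comp hu
  have h2 := (hΩ.tendsto_qhDist_zero hq).comp hv
  have h3 := (h1.add hc).add h2
  rw [zero_add, add_zero] at h3
  refine ge_of_tendsto h3 ?_
  filter_upwards [h, hu (hΩ.isOpen.mem_nhds hp), hv (hΩ.isOpen.mem_nhds hq)] with i hi hui hvi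
  have hui' : u i ∈ Ω := hui
  have hvi' : v i ∈ Ω := hvi
  have t1 := hΩ.qhDist_triangle hp hui' hq
  have t2 := hΩ.qhDist_triangle hui' hvi' hq
  have t3 := hΩ.qhDist_comm hvi' hq
  simp only [Function.comp_apply]
  linarith

lemma log_sub_log_le_qhDist (hΩ : IsQHDomain Ω k) {l : EuclideanSpace 𝕜 (Fin d) →L[ℝ] ℝ} {c : ℝ}
    (hl : ∀ x ∈ Ω, l x < c) (hp : p ∈ Ω) (hq : q ∈ Ω) :
    Real.log (c - l p) - Real.log (c - l q) ≤ qhDist 𝕜 Ω k p q :=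
  hΩ.le_qhDist hp hq fun σ a b h ha hb => by
    rw [← ha, ← hb]
    exact log_sub_log_le_qhLength hΩ.isOpen hΩ.isBounded hΩ.one_le hΩ.le_dim hl h

lemma isCompact_closedBall (hΩ : IsQHDomain Ω k) (hp : p ∈ Ω) (R : ℝ) :
    IsCompact {q | q ∈ Ω ∧ qhDist 𝕜 Ω k p q ≤ R} := by
  refine isCompact_of_isClosed_isBounded ?_ (hΩ.isBounded.subset fun q hq => hq.1)
  refine isClosed_of_closure_subset fun x hx => ?_
  obtain ⟨u, hu, hux⟩ := mem_closure_iff_seq_limit.1 hx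
  by_cases hxΩ : x ∈ Ω
  · exact ⟨hxΩ, hΩ.qhDist_le_of_tendsto hp hxΩ tendsto_const_nhds hux tendsto_const_nhds
      (Eventually.of_forall fun n => (hu n).2)⟩
  · exfalso
    obtain ⟨l, hl⟩ := geometric_hahn_banach_open_point hΩ.convex hΩ.isOpen hxΩ
    have hpos : ∀ y ∈ Ω, 0 < l x - l y := fun y hy => sub_pos.2 (hl y hy)
    have hb : ∀ n, (l x - l p) * Real.exp (-R) ≤ l x - l (u n) := fun n => by
      have h1 := (hΩ.log_sub_log_le_qhDist hl hp (hu n).1).trans (hu n).2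
      rw [← Real.log_le_log_iff (mul_pos (hpos p hp) (Real.exp_pos _)) (hpos _ (hu n).1),
        Real.log_mul (hpos p hp).ne' (Real.exp_pos _).ne', Real.log_exp]
      linarith
    have hlim : Tendsto (fun n => l x - l (u n)) atTop (𝓝 (l x - l x)) :=
      ((l.continuous.tendsto x).comp hux).const_sub _
    have := ge_of_tendsto' hlim hb
    rw [sub_self] at this
    exact this.not_gt (mul_pos (hpos p hp) (Real.exp_pos _))

lemma exists_almost_geodesic (hΩ : IsQHDomain Ω k) (hp : p ∈ Ω) (hq : q ∈ Ω) {L : ℝ}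
    (hL : qhDist 𝕜 Ω k p q < L) :
    ∃ x : ℝ → EuclideanSpace 𝕜 (Fin d), ∀ s ∈ Icc (0 : ℝ) 1, x s ∈ Ω ∧
      qhDist 𝕜 Ω k p (x s) ≤ s * L ∧ qhDist 𝕜 Ω k (x s) q ≤ (1 - s) * L ∧
      ∀ t ∈ Icc (0 : ℝ) 1, qhDist 𝕜 Ω k (x s) (x t) ≤ |s - t| * L := by
  obtain ⟨σ, a, b, hσ, rfl, rfl, hlt⟩ := hΩ.exists_qhLength_lt hp hq hL
  have hint := hσ.intervalIntegrable hΩ.isOpen hΩ.isBounded hΩ.one_le hΩ.le_dim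
  have hsub : ∀ s t, a ≤ s → s ≤ t → t ≤ b →
      qhLength 𝕜 Ω k σ a s + qhLength 𝕜 Ω k σ s t = qhLength 𝕜 Ω k σ a t := by
    intro s t has hst htb
    refine intervalIntegral.integral_add_adjacent_intervals ?_ ?_ <;>
    refine IsACCurveIn.intervalIntegrable (hσ.mono ?_ ?_ ?_) hΩ.isOpen hΩ.isBounded hΩ.one_le
      hΩ.le_dim <;> linarith
  have hcont : ContinuousOn (fun t => qhLength 𝕜 Ω k σ a t) (Icc a b) := by
    have := intervalIntegral.continuousOn_primitive_interval
      ((uIcc_of_le hσ.le).symm ▸ (intervalIntegrable_iff_integrableOn_Icc_of_le hσ.le).1 hint)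
    rwa [uIcc_of_le hσ.le] at this
  set ℓ := qhLength 𝕜 Ω k σ a b with hℓ
  have hℓ0 : 0 ≤ ℓ := qhLength_nonneg hσ.le
  have hex : ∀ s ∈ Icc (0 : ℝ) 1, ∃ t ∈ Icc a b, qhLength 𝕜 Ω k σ a t = s * ℓ := by
    intro s hs
    refine intermediate_value_Icc hσ.le hcont ⟨?_, ?_⟩
    · simpa [qhLength] using mul_nonneg hs.1 hℓ0
    · exact mul_le_of_le_one_left hℓ0 hs.2
  choose! T hT hTeq using hex
  have hdist : ∀ s ∈ Icc a b, ∀ t ∈ Icc a b, qhDist 𝕜 Ω k (σ s) (σ t) ≤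
      |qhLength 𝕜 Ω k σ a s - qhLength 𝕜 Ω k σ a t| := by
    intro s hs t ht
    wlog hst : s ≤ t generalizing s t
    · rw [hΩ.qhDist_comm (hσ.mem s hs) (hσ.mem t ht), abs_sub_comm]
      exact this t ht s hs (le_of_not_ge hst)
    · refine (qhDist_le_qhLength (hσ.mono hs.1 hst ht.2)).trans ?_
      rw [abs_sub_comm]
      refine le_trans (le_of_eq ?_) (le_abs_self _)
      linarith [hsub s t hs.1 hst ht.2]
  have hTdist : ∀ s ∈ Icc (0 : ℝ) 1, ∀ t ∈ Icc (0 : ℝ) 1,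
      qhDist 𝕜 Ω k (σ (T s)) (σ (T t)) ≤ |s - t| * L := by
    intro s hs t ht
    refine (hdist _ (hT s hs) _ (hT t ht)).trans ?_
    rw [hTeq s hs, hTeq t ht, ← sub_mul, abs_mul, abs_of_nonneg hℓ0]
    gcongr
  refine ⟨fun s => σ (T s), fun s hs => ⟨hσ.mem _ (hT s hs), ?_, ?_, hTdist s hs⟩⟩
  · refine (hdist a (left_mem_Icc.2 hσ.le) _ (hT s hs)).trans ?_
    have h0 : qhLength 𝕜 Ω k σ a a = 0 := by simp [qhLength]
    rw [hTeq s hs, h0, zero_sub, abs_neg, abs_of_nonneg (mul_nonneg hs.1 hℓ0)]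
    exact mul_le_mul_of_nonneg_left hlt.le hs.1
  · refine (hdist _ (hT s hs) b (right_mem_Icc.2 hσ.le)).trans ?_
    rw [hTeq s hs, abs_sub_comm, ← hℓ, show ℓ - s * ℓ = (1 - s) * ℓ by ring,
      abs_of_nonneg (mul_nonneg (sub_nonneg.2 hs.2) hℓ0)]
    exact mul_le_mul_of_nonneg_left hlt.le (sub_nonneg.2 hs.2)

lemma exists_geodesic (hΩ : IsQHDomain Ω k) (hp : p ∈ Ω) (hq : q ∈ Ω) :
    ∃ γ : ℝ → EuclideanSpace 𝕜 (Fin d),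
      (∀ t ∈ Icc 0 (qhDist 𝕜 Ω k p q), γ t ∈ Ω) ∧ γ 0 = p ∧ γ (qhDist 𝕜 Ω k p q) = q ∧
      ∀ s ∈ Icc 0 (qhDist 𝕜 Ω k p q), ∀ t ∈ Icc 0 (qhDist 𝕜 Ω k p q),
        qhDist 𝕜 Ω k (γ s) (γ t) = |s - t| := by
  set D := qhDist 𝕜 Ω k p q with hD
  have hD0 : 0 ≤ D := hΩ.qhDist_nonneg hp hq
  have hpos : ∀ n : ℕ, (0 : ℝ) < 1 / (n + 1) := fun n => Nat.one_div_pos_of_nat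
  choose x hx using fun n : ℕ => hΩ.exists_almost_geodesic hp hq
    (show qhDist 𝕜 Ω k p q < D + 1 / ((n : ℝ) + 1) by linarith [hpos n])
  have hsD : ∀ s ∈ Icc 0 D, s / D ∈ Icc (0 : ℝ) 1 := fun s hs =>
    ⟨div_nonneg hs.1 hD0, div_le_one_of_le₀ hs.2 hD0⟩
  have hcancel : ∀ s ∈ Icc 0 D, s / D * D = s := fun s hs => by
    rcases hD0.eq_or_lt with h | h
    · rw [← h, mul_zero]
      exact hs.1.antisymm (hs.2.trans_eq h.symm)
    · exact div_mul_cancel₀ s h.ne'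
  have hLlim : Tendsto (fun n : ℕ => D + 1 / ((n : ℝ) + 1)) (hyperfilter ℕ) (𝓝 D) := by
    have h := (tendsto_one_div_add_atTop_nhds_zero_nat (𝕜 := ℝ)).const_add D
    rw [add_zero] at h
    exact h.mono_left Nat.hyperfilter_le_atTop
  have hlim : ∀ s ∈ Icc 0 D, ∃ y ∈ Ω, Tendsto (fun n => x n (s / D)) (hyperfilter ℕ) (𝓝 y) := by
    intro s hs
    obtain ⟨y, hy, hle⟩ := (hΩ.isCompact_closedBall hp (D + 1)).ultrafilter_le_nhds'
      ((hyperfilter ℕ).map fun n => x n (s / D)) (by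
        refine Ultrafilter.mem_map.2 (univ_mem' fun n => ?_)
        have h := hx n _ (hsD s hs)
        refine ⟨h.1, h.2.1.trans ?_⟩
        have h1 : 1 / ((n : ℝ) + 1) ≤ 1 := by
          rw [div_le_one (by positivity)]
          linarith [(Nat.cast_nonneg n : (0 : ℝ) ≤ n)]
        exact (mul_le_of_le_one_left (by linarith [hpos n]) (hsD s hs).2).trans (by linarith))
    exact ⟨y, hy.1, hle⟩
  choose! γ hγΩ hγ using hlim
  have hle : ∀ s ∈ Icc 0 D, ∀ t ∈ Icc 0 D, qhDist 𝕜 Ω k (γ s) (γ t) ≤ |s - t| := by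
    intro s hs t ht
    have hc := hLlim.const_mul |s / D - t / D|
    have he : |s / D - t / D| * D = |s - t| := by
      rw [← abs_of_nonneg hD0, ← abs_mul, abs_of_nonneg hD0, sub_mul, hcancel s hs, hcancel t ht]
    rw [he] at hc
    exact hΩ.qhDist_le_of_tendsto (hγΩ s hs) (hγΩ t ht) (hγ s hs) (hγ t ht) hc
      (Eventually.of_forall fun n => (hx n _ (hsD s hs)).2.2.2 _ (hsD t ht))
  have hlep : ∀ s ∈ Icc 0 D, qhDist 𝕜 Ω k p (γ s) ≤ s := by
    intro s hs
    have hc := hLlim.const_mul (s / D)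
    rw [hcancel s hs] at hc
    exact hΩ.qhDist_le_of_tendsto hp (hγΩ s hs) tendsto_const_nhds (hγ s hs) hc
      (Eventually.of_forall fun n => (hx n _ (hsD s hs)).2.1)
  have hleq : ∀ s ∈ Icc 0 D, qhDist 𝕜 Ω k (γ s) q ≤ D - s := by
    intro s hs
    have hc := hLlim.const_mul (1 - s / D)
    rw [sub_mul, one_mul, hcancel s hs] at hc
    exact hΩ.qhDist_le_of_tendsto (hγΩ s hs) hq (hγ s hs) tendsto_const_nhds hc
      (Eventually.of_forall fun n => (hx n _ (hsD s hs)).2.2.1)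
  have h0 : (0 : ℝ) ∈ Icc 0 D := left_mem_Icc.2 hD0
  have h1 : D ∈ Icc 0 D := right_mem_Icc.2 hD0
  refine ⟨γ, hγΩ, ?_, ?_, fun s hs t ht => ?_⟩
  · exact ((hΩ.qhDist_eq_zero hp (hγΩ 0 h0)).1
      ((hlep 0 h0).antisymm (hΩ.qhDist_nonneg hp (hγΩ 0 h0)))).symm
  · exact (hΩ.qhDist_eq_zero (hγΩ D h1) hq).1
      (((hleq D h1).trans_eq (sub_self D)).antisymm (hΩ.qhDist_nonneg (hγΩ D h1) hq))
  · have hge : ∀ s ∈ Icc 0 D, ∀ t ∈ Icc 0 D, t - s ≤ qhDist 𝕜 Ω k (γ s) (γ t) := by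
      intro s hs t ht
      have t1 := hΩ.qhDist_triangle hp (hγΩ s hs) hq
      have t2 := hΩ.qhDist_triangle (hγΩ s hs) (hγΩ t ht) hq
      linarith [hlep s hs, hleq t ht]
    refine (hle s hs t ht).antisymm (abs_le'.2 ⟨?_, ?_⟩)
    · rw [hΩ.qhDist_comm (hγΩ s hs) (hγΩ t ht)]
      exact hge t ht s hs
    · rw [neg_sub]
      exact hge s hs t ht

end IsQHDomain

end Distance

/-- Corollary 7.2: on a bounded convex domain, `d_Ω^{(k)}` is a metric
generating the standard (Euclidean subspace) topology, and it is proper and geodesic. -/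
theorem stmt_15 {𝕜 : Type*} [RCLike 𝕜] {d : ℕ} (Ω : Set (EuclideanSpace 𝕜 (Fin d)))
    (hΩopen : IsOpen Ω) (hΩne : Ω.Nonempty) (hΩconv : Convex ℝ Ω)
    (hΩbdd : Bornology.IsBounded Ω) (k : ℕ) (hk1 : 1 ≤ k) (hkd : k ≤ d) :
    -- `d_Ω^{(k)}` is a metric on `Ω`:
    (∀ p ∈ Ω, ∀ q ∈ Ω, 0 ≤ qhDist 𝕜 Ω k p q) ∧
    (∀ p ∈ Ω, ∀ q ∈ Ω, (qhDist 𝕜 Ω k p q = 0 ↔ p = q)) ∧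
    (∀ p ∈ Ω, ∀ q ∈ Ω, qhDist 𝕜 Ω k p q = qhDist 𝕜 Ω k q p) ∧
    (∀ p ∈ Ω, ∀ q ∈ Ω, ∀ z ∈ Ω, qhDist 𝕜 Ω k p z ≤ qhDist 𝕜 Ω k p q + qhDist 𝕜 Ω k q z) ∧
    -- it generates the standard topology:
    (∀ p ∈ Ω, ∀ ε : ℝ, 0 < ε → ∃ η : ℝ, 0 < η ∧ ∀ q ∈ Ω,
      (dist p q < η → qhDist 𝕜 Ω k p q < ε) ∧ (qhDist 𝕜 Ω k p q < η → dist p q < ε)) ∧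
    -- properness: closed `d_Ω^{(k)}`-balls are compact:
    (∀ p ∈ Ω, ∀ R : ℝ, IsCompact {q | q ∈ Ω ∧ qhDist 𝕜 Ω k p q ≤ R}) ∧
    -- geodesicity:
    (∀ p ∈ Ω, ∀ q ∈ Ω, ∃ γ : ℝ → EuclideanSpace 𝕜 (Fin d),
      (∀ t ∈ Set.Icc 0 (qhDist 𝕜 Ω k p q), γ t ∈ Ω) ∧
      γ 0 = p ∧ γ (qhDist 𝕜 Ω k p q) = q ∧
      ∀ s ∈ Set.Icc 0 (qhDist 𝕜 Ω k p q), ∀ t ∈ Set.Icc 0 (qhDist 𝕜 Ω k p q),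
        qhDist 𝕜 Ω k (γ s) (γ t) = |s - t|) := by
  have hΩ : IsQHDomain Ω k := ⟨hΩopen, hΩconv, hΩbdd, hk1, hkd⟩
  refine ⟨fun p hp q hq => hΩ.qhDist_nonneg hp hq, fun p hp q hq => hΩ.qhDist_eq_zero hp hq,
    fun p hp q hq => hΩ.qhDist_comm hp hq, fun p hp q hq z hz => hΩ.qhDist_triangle hp hq hz,
    fun p hp ε hε => ?_, fun p hp R => hΩ.isCompact_closedBall hp R,
    fun p hp q hq => hΩ.exists_geodesic hp hq⟩
  obtain ⟨D, hD0, hD⟩ := hΩ.exists_norm_sub_le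
  obtain ⟨η, hη, hηε⟩ := Metric.eventually_nhds_iff.1
    ((hΩ.tendsto_qhDist_zero hp).eventually_lt_const hε)
  refine ⟨min η (ε / D), lt_min hη (div_pos hε hD0), fun q hq => ⟨fun h => ?_, fun h => ?_⟩⟩
  · exact hηε (by rw [dist_comm]; exact h.trans_le (min_le_left _ _))
  · rw [dist_comm, dist_eq_norm]
    exact (hD p hp q hq).trans_lt ((lt_div_iff₀' hD0).1 (h.trans_le (min_le_right _ _)))
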